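/- Let q ∈ ℝ with 0 < q < 1 and n ∈ ℕ. Then Σ_{k=0}^∞ q^{(n+1)k}/(q;q)_k converges and [n]_q! = ((q;q)_∞/(1−q)^n) · Σ_{k=0}^∞ q^{(n+1)k}/(q;q)_k. -/

import Mathlib

open Finset

/-- q-bracket `[n]_q = 1 + q + ⋯ + q^(n-1)` (real version). -/
noncomputable def qBracket (q : ℝ) (n : ℕ) : ℝ := ∑ j ∈ Finset.range n, q ^ j

/-- q-factorial `[n]_q! = [1]_q [2]_q ⋯ [n]_q`, with `[0]_q! = 1`. -/
noncomputable def qFact (q : ℝ) (n : ℕ) : ℝ := ∏ i ∈ Finset.range n, qBracket q (i + 1)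

/-- The finite q-Pochhammer symbol `(q;q)_k = ∏_{j=1}^k (1 - q^j)`, with `(q;q)_0 = 1`. -/
noncomputable def qPoch (q : ℝ) (k : ℕ) : ℝ := ∏ j ∈ Finset.Icc 1 k, (1 - q ^ j)

open Filter Topology in
theorem qPoch_succ_aux (q : ℝ) (k : ℕ) : qPoch q (k + 1) = qPoch q k * (1 - q ^ (k + 1)) := by
  unfold qPoch
  rw [Finset.prod_Icc_succ_top (by omega)]

theorem one_sub_pow_pos_aux (q : ℝ) (hq0 : 0 < q) (hq1 : q < 1) (k : ℕ) : 0 < 1 - q ^ (k + 1) :=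
  sub_pos.2 (pow_lt_one₀ hq0.le hq1 (by omega))

theorem qPoch_pos_aux (q : ℝ) (hq0 : 0 < q) (hq1 : q < 1) (k : ℕ) : 0 < qPoch q k := by
  induction k with
  | zero => simp [qPoch]
  | succ k ih =>
    rw [qPoch_succ_aux]
    exact mul_pos ih (one_sub_pow_pos_aux q hq0 hq1 k)

theorem qPoch_eq_prod_aux (q : ℝ) (k : ℕ) :
    qPoch q k = ∏ j ∈ Finset.range k, (1 - q ^ (j + 1)) := by
  induction k with
  | zero => simp [qPoch]
  | succ k ih => rw [qPoch_succ_aux, Finset.prod_range_succ, ih]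

theorem qFact_eq_aux (q : ℝ) (hq1 : q < 1) (n : ℕ) : qFact q n = qPoch q n / (1 - q) ^ n := by
  have h : (1 - q) ≠ 0 := (sub_pos.2 hq1).ne'
  rw [eq_div_iff (pow_ne_zero _ h)]
  induction n with
  | zero => simp [qPoch, qFact]
  | succ n ih =>
    have hb : qBracket q (n + 1) * (1 - q) = 1 - q ^ (n + 1) := by
      unfold qBracket
      exact geom_sum_mul_neg q (n + 1)
    have hf : qFact q (n + 1) = qFact q n * qBracket q (n + 1) := by
      unfold qFact
      rw [Finset.prod_range_succ]
    rw [qPoch_succ_aux, ← ih, ← hb, hf]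
    ring

open Filter Topology in
theorem summable_aux (q : ℝ) (hq0 : 0 < q) (hq1 : q < 1) (n : ℕ) :
    Summable (fun k : ℕ => q ^ ((n + 1) * k) / qPoch q k) := by
  have hlt : q ^ (n + 1) < 1 := pow_lt_one₀ hq0.le hq1 (by omega)
  refine summable_of_ratio_test_tendsto_lt_one hlt ?_ ?_
  · exact Eventually.of_forall fun k =>
      (div_pos (pow_pos hq0 _) (qPoch_pos_aux q hq0 hq1 k)).ne'
  · have h1 : Tendsto (fun k : ℕ => q ^ (n + 1) / (1 - q ^ (k + 1))) atTop
        (𝓝 (q ^ (n + 1) / (1 - 0))) := by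
      refine Tendsto.div tendsto_const_nhds (tendsto_const_nhds.sub ?_) (by norm_num)
      exact (tendsto_pow_atTop_nhds_zero_of_lt_one hq0.le hq1).comp (tendsto_add_atTop_nat 1)
    rw [sub_zero, div_one] at h1
    refine h1.congr fun k => ?_
    have hp := qPoch_pos_aux q hq0 hq1 k
    have hs := one_sub_pow_pos_aux q hq0 hq1 k
    have hp' := qPoch_pos_aux q hq0 hq1 (k + 1)
    rw [Real.norm_of_nonneg (by positivity), Real.norm_of_nonneg (by positivity), qPoch_succ_aux,
      mul_add, mul_one, pow_add]
    have := pow_pos hq0 ((n + 1) * k)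
    field_simp
    ring

theorem tsum_step_aux (q : ℝ) (hq0 : 0 < q) (hq1 : q < 1) (n : ℕ) :
    ∑' k : ℕ, q ^ ((n + 1 + 1) * k) / qPoch q k =
      (1 - q ^ (n + 1)) * ∑' k : ℕ, q ^ ((n + 1) * k) / qPoch q k := by
  have hs := summable_aux q hq0 hq1 n
  have hs' := summable_aux q hq0 hq1 (n + 1)
  have key : ∑' k : ℕ, (q ^ ((n + 1) * k) / qPoch q k - q ^ ((n + 1 + 1) * k) / qPoch q k) =
      q ^ (n + 1) * ∑' k : ℕ, q ^ ((n + 1) * k) / qPoch q k := by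
    rw [(hs.sub hs').tsum_eq_zero_add, ← tsum_mul_left]
    simp only [mul_zero, pow_zero, sub_self, zero_add]
    refine tsum_congr fun k => ?_
    have hp := qPoch_pos_aux q hq0 hq1 k
    have hs := one_sub_pow_pos_aux q hq0 hq1 k
    rw [qPoch_succ_aux, ← sub_div, ← mul_div_assoc, div_eq_div_iff (by positivity) (by positivity)]
    ring
  rw [hs.tsum_sub hs'] at key
  linarith

theorem tsum_eq_aux (q : ℝ) (hq0 : 0 < q) (hq1 : q < 1) (n : ℕ) :
    ∑' k : ℕ, q ^ ((n + 1) * k) / qPoch q k =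
      qPoch q n * ∑' k : ℕ, q ^ ((0 + 1) * k) / qPoch q k := by
  induction n with
  | zero => simp [qPoch]
  | succ n ih => rw [tsum_step_aux q hq0 hq1, ih, qPoch_succ_aux]; ring

open Filter Topology in
theorem tsum_tendsto_aux (q : ℝ) (hq0 : 0 < q) (hq1 : q < 1) :
    Tendsto (fun n : ℕ => ∑' k : ℕ, q ^ ((n + 1) * k) / qPoch q k) atTop (𝓝 1) := by
  set S := ∑' k : ℕ, q ^ ((0 + 1) * (k + 1)) / qPoch q (k + 1) with hS
  have hsum := fun n => (summable_nat_add_iff 1).2 (summable_aux q hq0 hq1 n)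
  have heq : ∀ n : ℕ, ∑' k : ℕ, q ^ ((n + 1) * k) / qPoch q k =
      1 + ∑' k : ℕ, q ^ ((n + 1) * (k + 1)) / qPoch q (k + 1) := fun n => by
    rw [(summable_aux q hq0 hq1 n).tsum_eq_zero_add]
    simp [qPoch]
  have hup : Tendsto (fun n : ℕ => 1 + q ^ n * S) atTop (𝓝 (1 + 0 * S)) :=
    tendsto_const_nhds.add
      ((tendsto_pow_atTop_nhds_zero_of_lt_one hq0.le hq1).mul tendsto_const_nhds)
  rw [zero_mul, add_zero] at hup
  refine tendsto_of_tendsto_of_tendsto_of_le_of_le tendsto_const_nhds hup ?_ ?_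
  · intro n
    simp only [heq]
    have : 0 ≤ ∑' k : ℕ, q ^ ((n + 1) * (k + 1)) / qPoch q (k + 1) :=
      tsum_nonneg fun k => (div_pos (pow_pos hq0 _) (qPoch_pos_aux q hq0 hq1 _)).le
    linarith
  · intro n
    simp only [heq]
    rw [hS, ← tsum_mul_left]
    gcongr 1 + ?_
    refine (hsum n).tsum_le_tsum (fun k => ?_) ((hsum 0).mul_left _)
    have hp := qPoch_pos_aux q hq0 hq1 (k + 1)
    rw [← mul_div_assoc, ← pow_add]
    refine div_le_div_of_nonneg_right ?_ hp.le
    exact pow_le_pow_of_le_one hq0.le hq1.le (by nlinarith [Nat.zero_le (n * k)])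

/-- For `0 < q < 1` and `n ∈ ℕ`, the infinite product `(q;q)_∞ = ∏_{j=1}^∞ (1 − q^j)`
converges, the series `Σ_{k=0}^∞ q^((n+1)k)/(q;q)_k` converges, and
`[n]_q! = ((q;q)_∞/(1−q)^n) · Σ_{k=0}^∞ q^((n+1)k)/(q;q)_k`. -/
theorem qFact_moment_formula (q : ℝ) (hq0 : 0 < q) (hq1 : q < 1) (n : ℕ) :
    Multipliable (fun j : ℕ => 1 - q ^ (j + 1)) ∧
    Summable (fun k : ℕ => q ^ ((n + 1) * k) / qPoch q k) ∧
    qFact q n = ((∏' j : ℕ, (1 - q ^ (j + 1))) / (1 - q) ^ n) *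
      ∑' k : ℕ, q ^ ((n + 1) * k) / qPoch q k := by
  have hm : Multipliable (fun j : ℕ => 1 - q ^ (j + 1)) := by
    have hg : Summable (fun j : ℕ => -q ^ (j + 1)) :=
      ((summable_nat_add_iff 1).2 (summable_geometric_of_lt_one hq0.le hq1)).neg
    simpa [sub_eq_add_neg] using Real.multipliable_one_add_of_summable hg
  refine ⟨hm, summable_aux q hq0 hq1 n, ?_⟩
  have h1 := hm.tendsto_prod_tprod_nat.mul_const (∑' k : ℕ, q ^ ((0 + 1) * k) / qPoch q k)
  have h2 := tsum_tendsto_aux q hq0 hq1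
  have h3 := tendsto_nhds_unique h1 (h2.congr fun m => by
    rw [tsum_eq_aux q hq0 hq1 m, qPoch_eq_prod_aux])
  rw [tsum_eq_aux q hq0 hq1 n, qFact_eq_aux q hq1]
  linear_combination (-(qPoch q n / (1 - q) ^ n)) * h3
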